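/- For every T ∈ ℝ, the function u(t,r) := 2 arctan(r/(T−t)) satisfies the corotational wave maps equation ∂_t²u(t,r) − ∂_r²u(t,r) − (2/r)∂_r u(t,r) + sin(2u(t,r))/r² = 0 at every point (t,r) with t ≠ T and r > 0. -/

import Mathlib

/-- The quadruple-angle value `sin (4 arctan x)` as a rational function of `x`. -/
theorem sin_four_mul_arctan (x : ℝ) :
    Real.sin (2 * (2 * Real.arctan x)) = 4 * x * (1 - x ^ 2) / (1 + x ^ 2) ^ 2 := by
  have hpos : (0 : ℝ) < 1 + x ^ 2 := by positivity
  have hcos : Real.cos (Real.arctan x) ^ 2 = 1 / (1 + x ^ 2) := Real.cos_sq_arctan x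
  have hsin : Real.sin (Real.arctan x) = x * Real.cos (Real.arctan x) := by
    rw [Real.sin_arctan, Real.cos_arctan, mul_one_div]
  rw [Real.sin_two_mul, Real.sin_two_mul, Real.cos_two_mul, hsin]
  calc 2 * (2 * (x * Real.cos (Real.arctan x)) * Real.cos (Real.arctan x))
        * (2 * Real.cos (Real.arctan x) ^ 2 - 1)
      = 4 * x * Real.cos (Real.arctan x) ^ 2 * (2 * Real.cos (Real.arctan x) ^ 2 - 1) := by ring
    _ = 4 * x * (1 - x ^ 2) / (1 + x ^ 2) ^ 2 := by
      rw [hcos]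
      field_simp
      ring

/-- The time derivative of the blowup profile. -/
theorem hasDerivAt_two_mul_arctan_time {T s : ℝ} (r : ℝ) (hs : s ≠ T) :
    HasDerivAt (fun s => 2 * Real.arctan (r / (T - s))) (2 * r / ((T - s) ^ 2 + r ^ 2)) s := by
  have ha : T - s ≠ 0 := sub_ne_zero.mpr hs.symm
  have hD : (T - s) ^ 2 + r ^ 2 ≠ 0 := by positivity
  have h := (((hasDerivAt_const s r).div ((hasDerivAt_id s).const_sub T) ha).arctan).const_mul 2
  refine h.congr_deriv ?_
  simp only [Pi.div_apply, id]
  field_simp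
  ring

/-- The radial derivative of the blowup profile. -/
theorem hasDerivAt_two_mul_arctan_radial {a : ℝ} (ha : a ≠ 0) (ρ : ℝ) :
    HasDerivAt (fun ρ => 2 * Real.arctan (ρ / a)) (2 * a / (a ^ 2 + ρ ^ 2)) ρ := by
  have hD : a ^ 2 + ρ ^ 2 ≠ 0 := by positivity
  have h := (((hasDerivAt_id ρ).div_const a).arctan).const_mul 2
  refine h.congr_deriv ?_
  simp only [id]
  field_simp

/-- The blowup solution `u(t,r) = 2 arctan(r/(T−t))` satisfies the corotational
wave maps equation away from the singular point `(T,0)`. -/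
theorem blowup_solves_corotational_wave_maps (T : ℝ)
    (u : ℝ → ℝ → ℝ) (hu : ∀ t r, u t r = 2 * Real.arctan (r / (T - t))) :
    ∀ t r : ℝ, t ≠ T → 0 < r →
      deriv (fun s => deriv (fun s' => u s' r) s) t
        - deriv (fun ρ => deriv (fun ρ' => u t ρ') ρ) r
        - (2 / r) * deriv (fun ρ => u t ρ) r
        + Real.sin (2 * u t r) / r ^ 2 = 0 := by
  intro t r ht hr
  simp only [hu]
  have ha : T - t ≠ 0 := sub_ne_zero.mpr ht.symm
  have hD : (T - t) ^ 2 + r ^ 2 ≠ 0 := by positivity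
  have htime : (fun s => deriv (fun s' => 2 * Real.arctan (r / (T - s'))) s) =ᶠ[nhds t]
      fun s => 2 * r / ((T - s) ^ 2 + r ^ 2) := by
    filter_upwards [isOpen_ne.mem_nhds ht] with s hs
    exact (hasDerivAt_two_mul_arctan_time r hs).deriv
  have hradial : (fun ρ => deriv (fun ρ' => 2 * Real.arctan (ρ' / (T - t))) ρ) =
      fun ρ => 2 * (T - t) / ((T - t) ^ 2 + ρ ^ 2) :=
    funext fun ρ => (hasDerivAt_two_mul_arctan_radial ha ρ).deriv
  have htt : HasDerivAt (fun s => 2 * r / ((T - s) ^ 2 + r ^ 2))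
      (4 * r * (T - t) / ((T - t) ^ 2 + r ^ 2) ^ 2) t := by
    have h := (hasDerivAt_const t (2 * r)).fun_div
      ((((hasDerivAt_id' t).const_sub T).fun_pow 2).add_const (r ^ 2)) hD
    refine h.congr_deriv ?_
    norm_num
    ring
  have hrr : HasDerivAt (fun ρ => 2 * (T - t) / ((T - t) ^ 2 + ρ ^ 2))
      (-(4 * r * (T - t)) / ((T - t) ^ 2 + r ^ 2) ^ 2) r := by
    have h := (hasDerivAt_const r (2 * (T - t))).fun_div
      (((hasDerivAt_id' r).fun_pow 2).const_add ((T - t) ^ 2)) hD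
    refine h.congr_deriv ?_
    norm_num
    ring
  rw [htime.deriv_eq, htt.deriv, hradial, hrr.deriv,
    (hasDerivAt_two_mul_arctan_radial ha r).deriv, sin_four_mul_arctan]
  generalize T - t = a at ha hD ⊢
  have hsum : 1 + (r / a) ^ 2 = (a ^ 2 + r ^ 2) / a ^ 2 := by field_simp
  rw [hsum]
  field_simp
  ring
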